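/- arXiv:2205.01444 — 2 statements merged into one kernel-verified Lean document; each statement's English description precedes it below -/
import Mathlib

section
/- Let V and W be real numbers with 0 < V < W. Then the function h ↦ V·(1+(W/V)^{h+1})/(1+(W/V)^h) is strictly monotonically increasing on ℝ. Consequently, for any q > 0, the function h ↦ q·√(V·(1+(W/V)^{h+1})/(1+(W/V)^h)) is strictlymonotonically increasing on ℝ. -/
/-- For a base `r > 1`, the map `h ↦ (1 + r ^ (h + 1)) / (1 + r ^ h)`, scaled by a positive
constant, is strictly increasing. -/
theorem strictMono_mul_one_add_rpow_div {V r : ℝ} (hV : 0 < V) (hr : 1 < r) :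
    StrictMono (fun h : ℝ => V * (1 + r ^ (h + 1)) / (1 + r ^ h)) := by
  intro a b hab
  have hr0 : 0 < r := one_pos.trans hr
  have hlt : r ^ a < r ^ b := Real.rpow_lt_rpow_of_exponent_lt hr hab
  have hpos : 0 < V * ((r - 1) * (r ^ b - r ^ a)) :=
    mul_pos hV (mul_pos (sub_pos.2 hr) (sub_pos.2 hlt))
  simp only [Real.rpow_add_one hr0.ne']
  rw [div_lt_div_iff₀ (by positivity) (by positivity)]
  linarith

/-- For `0 < V < W`, the map `h ↦ V·(1+(W/V)^(h+1))/(1+(W/V)^h)` is strictly increasing on ℝ,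
and consequently for any `q > 0`, `h ↦ q·√(V·(1+(W/V)^(h+1))/(1+(W/V)^h))` is strictly
increasing on ℝ. -/
theorem strictMono_in_h (V W : ℝ) (hV : 0 < V) (hVW : V < W) :
    StrictMono (fun h : ℝ => V * (1 + (W / V) ^ (h + 1)) / (1 + (W / V) ^ h)) ∧
      ∀ q : ℝ, 0 < q →
        StrictMono
          (fun h : ℝ => q * Real.sqrt (V * (1 + (W / V) ^ (h + 1)) / (1 + (W / V) ^ h))) := by
  have hW : 0 < W := hV.trans hVW
  have hmono := strictMono_mul_one_add_rpow_div hV ((one_lt_div hV).2 hVW)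
  refine ⟨hmono, fun q hq a b hab => mul_lt_mul_of_pos_left ?_ hq⟩
  exact Real.sqrt_lt_sqrt (by positivity) (hmono hab)
end

section
/- Let V and W be real numbers with 0 < W < V. Then the function l ↦ (V + (V/W)^l·W)/(1+(V/W)^l) is strictly monotonically decreasing on ℝ. Consequently, for any q > 0, the function l ↦ q·√((V + (V/W)^l·W)/(1+(V/W)^l)) is strictly monotonically decreasing on ℝ. -/
/-- The weighted mean `(V + x * W) / (1 + x)` strictly decreases in the weight `x ≥ 0` of the
smaller value `W`. -/
lemma strictAntiOn_weighted_mean {V W : ℝ} (hWV : W < V) :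
    StrictAntiOn (fun x : ℝ => (V + x * W) / (1 + x)) (Set.Ici 0) := by
  intro x hx y hy hxy
  rw [Set.mem_Ici] at hx hy
  change (V + y * W) / (1 + y) < (V + x * W) / (1 + x)
  rw [div_lt_div_iff₀ (by positivity) (by positivity)]
  nlinarith [mul_pos (sub_pos.2 hWV) (sub_pos.2 hxy)]


/-- For `0 < W < V`, the map `l ↦ (V + (V/W)^l·W)/(1+(V/W)^l)` is strictly decreasing on ℝ,
and consequently for any `q > 0`, `l ↦ q·√((V + (V/W)^l·W)/(1+(V/W)^l))` is strictly
decreasing on ℝ. -/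
theorem strictAnti_in_l (V W : ℝ) (hW : 0 < W) (hWV : W < V) :
    StrictAnti (fun l : ℝ => (V + (V / W) ^ l * W) / (1 + (V / W) ^ l)) ∧
      ∀ q : ℝ, 0 < q →
        StrictAnti
          (fun l : ℝ => q * Real.sqrt ((V + (V / W) ^ l * W) / (1 + (V / W) ^ l))) := by
  have hV : 0 < V := hW.trans hWV
  have hpos (l : ℝ) : 0 < (V / W) ^ l := Real.rpow_pos_of_pos (div_pos hV hW) l
  have hanti : StrictAnti (fun l : ℝ => (V + (V / W) ^ l * W) / (1 + (V / W) ^ l)) :=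
    fun a b hab => strictAntiOn_weighted_mean hWV (hpos a).le (hpos b).le
      (Real.rpow_lt_rpow_of_exponent_lt ((one_lt_div hW).2 hWV) hab)
  refine ⟨hanti, fun q hq a b hab => mul_lt_mul_of_pos_left ?_ hq⟩
  have hb := hpos b
  exact Real.sqrt_lt_sqrt (by positivity) (hanti hab)
end
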